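/- The following network has no scalar linear solution over the field F_2 with two elements. Vertices: 1, 2, 3', 3, 4', 4, 5, 6, 7, 8, 9, 10. Node 1 has an input edge generating the message x_1 and node 2 has an input edge generating the message x_2. Edges: 1→3', 2→3', 3'→3, 1→4', 2→4', 4'→4, 1→5, 3→5, 2→6, 3→6, 1→7, 4→7, 2→8, 4→8, 3→9, 4→9, 3→10, 4→10. Demands: node 5 demands x_2, node 6 demands x_1, node 7 demands x_2, node 8 demands x_1, node 9 demands x_1, node 10 demands x_2. -/

import Mathlib

open scoped Classical

structure Network where
  V : Type
  E : Type
  [fintV : Fintype V]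
  [fintE : Fintype E]
  hd : E → V
  tl : E → V
  acyclic : ∃ f : V → ℕ, ∀ e : E, f (hd e) < f (tl e)
  demand : V → Set E
  demand_isInput : ∀ v : V, ∀ e ∈ demand v, ∀ e' : E, tl e' ≠ hd e

namespace Network

variable (N : Network)

instance : Fintype N.V := N.fintV
instance : Fintype N.E := N.fintE

/-- An input edge: its head vertex has in-degree zero. -/
def IsInput (e : N.E) : Prop := ∀ e' : N.E, N.tl e' ≠ N.hd e

/-- The set of input edges, as a type. -/
abbrev InputEdge : Type := {e : N.E // N.IsInput e}

/-- The space of message tuples: input edge `i` generates a row vector of length `k i`. -/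
abbrev MsgSpace (F : Type) (k : N.InputEdge → ℕ) : Type :=
  ∀ i : N.InputEdge, Fin (k i) → F

/-- Incoming edges of a vertex. -/
def inSet (v : N.V) : Set N.E := {e | N.tl e = v}

/-- Outgoing intermediate edges of a vertex, together with its demands. -/
def outSet (v : N.V) : Set N.E :=
  {e | N.hd e = v ∧ ¬ N.IsInput e} ∪ N.demand v

/-- A `(k;n)`-fractional network coding solution over `F`.  The value carried by an input
edge is its message (condition (N1) is thus built in); `φ` gives the values carried by the
intermediate edges; `decode` is condition (N2) and `localEnc` is condition (N3). -/
structure FNCSol (F : Type) [Field F] (k : N.InputEdge → ℕ) (n : ℕ) where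
  φ : ∀ e : N.E, ¬ N.IsInput e → N.MsgSpace F k → (Fin n → F)
  decode : ∀ (v : N.V) (j : N.E) (hj : j ∈ N.demand v),
    ∃ χ : ((∀ i : {i : N.InputEdge // N.tl i.1 = v}, Fin (k i.1) → F) ×
           (∀ e : {e : N.E // N.tl e = v ∧ ¬ N.IsInput e}, Fin n → F)) →
          (Fin (k ⟨j, N.demand_isInput v j hj⟩) → F),
      ∀ x : N.MsgSpace F k,
        χ (fun i => x i.1, fun e => φ e.1 e.2.2 x) = x ⟨j, N.demand_isInput v j hj⟩
  localEnc : ∀ (e : N.E) (he : ¬ N.IsInput e),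
    ∃ g : ((∀ i : {i : N.InputEdge // N.tl i.1 = N.hd e}, Fin (k i.1) → F) ×
           (∀ e' : {e' : N.E // N.tl e' = N.hd e ∧ ¬ N.IsInput e'}, Fin n → F)) →
          (Fin n → F),
      ∀ x : N.MsgSpace F k, φ e he x = g (fun i => x i.1, fun e' => φ e'.1 e'.2.2 x)

/-- A solution is linear if all global encoding functions, all decoding functions and all
local encoding functions are `F`-linear. -/
def FNCSol.IsLinear {N : Network} {F : Type} [Field F] {k : N.InputEdge → ℕ} {n : ℕ}
    (sol : N.FNCSol F k n) : Prop :=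
  (∀ (e : N.E) (he : ¬ N.IsInput e), IsLinearMap F (sol.φ e he)) ∧
  (∀ (v : N.V) (j : N.E) (hj : j ∈ N.demand v),
    ∃ χ : ((∀ i : {i : N.InputEdge // N.tl i.1 = v}, Fin (k i.1) → F) ×
           (∀ e : {e : N.E // N.tl e = v ∧ ¬ N.IsInput e}, Fin n → F)) →
          (Fin (k ⟨j, N.demand_isInput v j hj⟩) → F),
      IsLinearMap F χ ∧
      ∀ x : N.MsgSpace F k,
        χ (fun i => x i.1, fun e => sol.φ e.1 e.2.2 x) = x ⟨j, N.demand_isInput v j hj⟩) ∧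
  (∀ (e : N.E) (he : ¬ N.IsInput e),
    ∃ g : ((∀ i : {i : N.InputEdge // N.tl i.1 = N.hd e}, Fin (k i.1) → F) ×
           (∀ e' : {e' : N.E // N.tl e' = N.hd e ∧ ¬ N.IsInput e'}, Fin n → F)) →
          (Fin n → F),
      IsLinearMap F g ∧
      ∀ x : N.MsgSpace F k, sol.φ e he x = g (fun i => x i.1, fun e' => sol.φ e'.1 e'.2.2 x))

end Network

/-- The network of Fig. 5, constructed from the discrete polymatroid `2D(U_{2,4})`.
Vertices `0,1` are auxiliary sources; `2,3` are the nodes `1,2` receiving the input edges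
generating `x_1,x_2`; `4,5,6,7` are `3',3,4',4`; and `8,…,13` are the demanding nodes
`5,…,10`. -/
def paperNet : Network where
  V := Fin 14
  E := Fin 20
  hd := ![0,1,2,3,4,2,3,6,2,5,3,5,2,7,3,7,5,7,5,7]
  tl := ![2,3,4,4,5,6,6,7,8,8,9,9,10,10,11,11,12,12,13,13]
  acyclic := ⟨![0,0,1,1,2,3,2,3,4,4,4,4,4,4], by decide⟩
  demand := fun v => {e | (v = 8 ∧ e = 1) ∨ (v = 9 ∧ e = 0) ∨ (v = 10 ∧ e = 1) ∨
    (v = 11 ∧ e = 0) ∨ (v = 12 ∧ e = 0) ∨ (v = 13 ∧ e = 1)}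
  demand_isInput := by
    intro v e he e'
    rcases he with ⟨_, rfl⟩|⟨_, rfl⟩|⟨_, rfl⟩|⟨_, rfl⟩|⟨_, rfl⟩|⟨_, rfl⟩ <;>
      (revert e'; decide)

namespace Network

/-- Two message tuples agree on the edge `e` under a solution if `e` carries the same value
for both of them. -/
def FNCSol.Agree {N : Network} {F : Type} [Field F] {k : N.InputEdge → ℕ} {n : ℕ}
    (sol : N.FNCSol F k n) (x y : N.MsgSpace F k) (e : N.E) : Prop :=
  (∀ h : N.IsInput e, x ⟨e, h⟩ = y ⟨e, h⟩) ∧ ∀ h : ¬ N.IsInput e, sol.φ e h x = sol.φ e h y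

variable {N : Network} {F : Type} [Field F] {k : N.InputEdge → ℕ} {n : ℕ}
  (sol : N.FNCSol F k n) {x y : N.MsgSpace F k}

/-- Message tuples agreeing on all incoming edges of a vertex agree on its demands. -/
theorem FNCSol.agree_of_mem_demand {v : N.V} {j : N.E} (hj : j ∈ N.demand v)
    (h : ∀ e, N.tl e = v → sol.Agree x y e) : sol.Agree x y j := by
  refine ⟨fun _ => ?_, fun hn => absurd (N.demand_isInput v j hj) hn⟩
  obtain ⟨χ, hχ⟩ := sol.decode v j hj
  rw [← hχ x, ← hχ y]
  congr 2
  · funext i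
    exact (h i.1.1 i.2).1 i.1.2
  · funext e
    exact (h e.1 e.2.1).2 e.2.2

/-- Message tuples agreeing on all incoming edges of the head of an intermediate edge agree
on that edge. -/
theorem FNCSol.agree_of_not_isInput {e : N.E} (he : ¬ N.IsInput e)
    (h : ∀ e', N.tl e' = N.hd e → sol.Agree x y e') : sol.Agree x y e := by
  refine ⟨fun hi => absurd hi he, fun _ => ?_⟩
  obtain ⟨g, hg⟩ := sol.localEnc e he
  rw [hg x, hg y]
  congr 2
  · funext i
    exact (h i.1.1 i.2).1 i.1.2
  · funext e'
    exact (h e'.1 e'.2.1).2 e'.2.2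

end Network

/-- The input edges of `paperNet` are the edges `0` and `1`. -/
theorem paperNet_isInput_iff (e : Fin 20) : paperNet.IsInput e ↔ e = 0 ∨ e = 1 := by
  change (∀ e' : Fin 20, (![2,3,4,4,5,6,6,7,8,8,9,9,10,10,11,11,12,12,13,13] e' : Fin 14) ≠
    ![0,1,2,3,4,2,3,6,2,5,3,5,2,7,3,7,5,7,5,7] e) ↔ _
  revert e
  decide

/-- An intermediate edge of `paperNet` whose head has the single incoming edge `a` carries a
function of the value carried by `a`. -/
theorem paperNet_agree_of_unique {F : Type} [Field F] {k : paperNet.InputEdge → ℕ} {n : ℕ}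
    (sol : paperNet.FNCSol F k n) {x y : paperNet.MsgSpace F k} {a : Fin 20} (e : Fin 20)
    (ha : sol.Agree x y a) (he : e ≠ 0 ∧ e ≠ 1)
    (hu : ∀ e' : Fin 20, (![2,3,4,4,5,6,6,7,8,8,9,9,10,10,11,11,12,12,13,13] e' : Fin 14) =
      ![0,1,2,3,4,2,3,6,2,5,3,5,2,7,3,7,5,7,5,7] e → e' = a) : sol.Agree x y e := by
  refine sol.agree_of_not_isInput ?_ fun e' h => ?_
  · rw [paperNet_isInput_iff]
    tauto
  · rw [hu e' h]
    exact ha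

/-- If the demanding vertex `v` of `paperNet` has two incoming edges `b₁` and `b₂`, which carry
functions of the values carried by `a₁` and `a₂`, then its demands are determined by the
latter. -/
theorem paperNet_agree_of_demand {F : Type} [Field F] {k : paperNet.InputEdge → ℕ} {n : ℕ}
    (sol : paperNet.FNCSol F k n) {x y : paperNet.MsgSpace F k} {a₁ a₂ j : Fin 20} (v : Fin 14)
    (b₁ b₂ : Fin 20) (h₁ : sol.Agree x y a₁) (h₂ : sol.Agree x y a₂)
    (hj : (v = 8 ∧ j = 1) ∨ (v = 9 ∧ j = 0) ∨ (v = 10 ∧ j = 1) ∨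
      (v = 11 ∧ j = 0) ∨ (v = 12 ∧ j = 0) ∨ (v = 13 ∧ j = 1))
    (hv : ∀ e : Fin 20, (![2,3,4,4,5,6,6,7,8,8,9,9,10,10,11,11,12,12,13,13] e : Fin 14) = v →
      e = b₁ ∨ e = b₂)
    (hb : (b₁ ≠ 0 ∧ b₁ ≠ 1) ∧ b₂ ≠ 0 ∧ b₂ ≠ 1)
    (hu₁ : ∀ e' : Fin 20, (![2,3,4,4,5,6,6,7,8,8,9,9,10,10,11,11,12,12,13,13] e' : Fin 14) =
      ![0,1,2,3,4,2,3,6,2,5,3,5,2,7,3,7,5,7,5,7] b₁ → e' = a₁)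
    (hu₂ : ∀ e' : Fin 20, (![2,3,4,4,5,6,6,7,8,8,9,9,10,10,11,11,12,12,13,13] e' : Fin 14) =
      ![0,1,2,3,4,2,3,6,2,5,3,5,2,7,3,7,5,7,5,7] b₂ → e' = a₂) : sol.Agree x y j := by
  refine sol.agree_of_mem_demand hj fun e he => ?_
  obtain rfl | rfl := hv e he
  · exact paperNet_agree_of_unique sol e h₁ hb.1 hu₁
  · exact paperNet_agree_of_unique sol e h₂ hb.2 hu₂

/-- The message tuple of `paperNet` with `x_1 = a` and `x_2 = b`. -/
def paperNetMsg (a b : ZMod 2) : paperNet.MsgSpace (ZMod 2) (fun _ => 1) :=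
  fun i _ => (fun e : Fin 20 => if e = 0 then a else b) i.1

/-- An additive map on the message tuples over `F_2` with scalar values which is nonzero on
`(1, 0)` and on `(0, 1)` vanishes on `(1, 1)`. -/
theorem map_paperNetMsg_one_one
    {f : paperNet.MsgSpace (ZMod 2) (fun _ => 1) → (Fin 1 → ZMod 2)}
    (hf : IsLinearMap (ZMod 2) f)
    (h₁ : f (paperNetMsg 1 0) ≠ f 0) (h₂ : f (paperNetMsg 0 1) ≠ f 0) :
    f (paperNetMsg 1 1) = f 0 := by
  have hadd : paperNetMsg 1 1 = paperNetMsg 1 0 + paperNetMsg 0 1 := by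
    funext i l
    simp only [paperNetMsg, Pi.add_apply]
    split_ifs <;> simp
  rw [hf.map_zero] at h₁ h₂ ⊢
  rw [hadd, hf.map_add]
  generalize f (paperNetMsg 1 0) = u at *
  generalize f (paperNetMsg 0 1) = w at *
  revert u w
  decide

/-- **Lemma 1.** The network constructed from `2D(U_{2,4})` (Fig. 5) has no scalar linear
solution over `F_2`. -/
theorem paperNet_no_scalar_linear_solution_F2 :
    ¬ ∃ sol : paperNet.FNCSol (ZMod 2) (fun _ => 1) 1, sol.IsLinear := by
  rintro ⟨sol, hlin, -⟩
  have h0 : paperNet.IsInput (0 : Fin 20) := (paperNet_isInput_iff 0).2 (Or.inl rfl)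
  have h1 : paperNet.IsInput (1 : Fin 20) := (paperNet_isInput_iff 1).2 (Or.inr rfl)
  have h4 : ¬ paperNet.IsInput (4 : Fin 20) := by rw [paperNet_isInput_iff]; decide
  have h7 : ¬ paperNet.IsInput (7 : Fin 20) := by rw [paperNet_isInput_iff]; decide
  have agree0 (b : ZMod 2) : sol.Agree (paperNetMsg 0 b) 0 (0 : Fin 20) :=
    ⟨fun _ => rfl, fun h => absurd h0 h⟩
  have agree1 (a : ZMod 2) : sol.Agree (paperNetMsg a 0) 0 (1 : Fin 20) :=
    ⟨fun _ => rfl, fun h => absurd h1 h⟩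
  have disagree0 (b : ZMod 2) : ¬ sol.Agree (paperNetMsg 1 b) 0 (0 : Fin 20) := fun h =>
    one_ne_zero (α := ZMod 2) (congrFun (h.1 h0) 0)
  have disagree1 (a : ZMod 2) : ¬ sol.Agree (paperNetMsg a 1) 0 (1 : Fin 20) := fun h =>
    one_ne_zero (α := ZMod 2) (congrFun (h.1 h1) 0)
  have agree4 {x} (h : sol.φ (4 : Fin 20) h4 x = sol.φ (4 : Fin 20) h4 0) :
      sol.Agree x 0 (4 : Fin 20) := ⟨fun h' => absurd h' h4, fun _ => h⟩
  have agree7 {x} (h : sol.φ (7 : Fin 20) h7 x = sol.φ (7 : Fin 20) h7 0) :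
      sol.Agree x 0 (7 : Fin 20) := ⟨fun h' => absurd h' h7, fun _ => h⟩
  have eq4 := map_paperNetMsg_one_one (hlin (4 : Fin 20) h4)
    (fun h => disagree0 0 <| paperNet_agree_of_demand sol 9 10 11 (agree1 1) (agree4 h)
      (by decide) (by decide) (by decide) (by decide) (by decide))
    (fun h => disagree1 0 <| paperNet_agree_of_demand sol 8 8 9 (agree0 1) (agree4 h)
      (by decide) (by decide) (by decide) (by decide) (by decide))
  have eq7 := map_paperNetMsg_one_one (hlin (7 : Fin 20) h7)
    (fun h => disagree0 0 <| paperNet_agree_of_demand sol 11 14 15 (agree1 1) (agree7 h)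
      (by decide) (by decide) (by decide) (by decide) (by decide))
    (fun h => disagree1 0 <| paperNet_agree_of_demand sol 10 12 13 (agree0 1) (agree7 h)
      (by decide) (by decide) (by decide) (by decide) (by decide))
  exact disagree0 1 <| paperNet_agree_of_demand sol 12 16 17 (agree4 eq4) (agree7 eq7)
    (by decide) (by decide) (by decide) (by decide) (by decide)
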